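/- arXiv:2504.18075 — 5 statements merged into one kernel-verified Lean document; each statement's English description precedes it below -/
import Mathlib

section
/- Consider fictitious play in a finite extensive-form game G of perfect recall in which all players have a common payoff u : Z → ℝ. Along any infinite play-path with empirical frequencies {f_t}, for every round t one has the decomposition u(f_{t+1}) − u(f_t) = Σ_{h∈H} (I_t(h)/#_t(h)) V_{f_t}(h) + ε_t, where ε_t := Σ_{z∈Z} u(z) Σ_{J ⊆ [1,ℓ_z), |J| ≥ 2} [∏_{ℓ∈J} δ_t(n_{ℓ+1}|h(n_ℓ))] · [∏_{ℓ∈[1,ℓ_z)∖J} f_t(n_{ℓ+1}|h(n_ℓ))], with (n_1,…,n_{ℓ_z}) the root path to z and δ_t(a|h) := (I_t(h)/#_t(h))(I_t(a) − f_t(a|h)); moreover Σ_{t∈ℕ} |ε_t| < ∞. -/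
open Classical Filter MeasureTheory
open scoped BigOperators

noncomputable section

/-- A finite extensive-form game (no chance moves): a finite rooted tree with
decision and terminal nodes, moves, information sets and players. -/
structure ExtGame where
  Node : Type
  Move : Type
  Info : Type
  Player : Type
  nodeFintype : Fintype Node
  nodeDecEq : DecidableEq Node
  moveFintype : Fintype Move
  moveDecEq : DecidableEq Move
  infoFintype : Fintype Info
  infoDecEq : DecidableEq Info
  playerFintype : Fintype Player
  playerDecEq : DecidableEq Player
  root : Node
  /-- the immediate predecessor of a node together with the move leading from it;
  `none` exactly at the root -/
  parentMove : Node → Option (Node × Move)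
  /-- depth of a node in the tree (ensures acyclicity) -/
  rank : Node → ℕ
  parentMove_root : parentMove root = none
  eq_root_of_parentMove_eq_none : ∀ n, parentMove n = none → n = root
  rank_succ : ∀ n m a, parentMove n = some (m, a) → rank n = rank m + 1
  /-- decision nodes; the remaining nodes are terminal -/
  decision : Node → Prop
  /-- the information set containing a (decision) node -/
  info : Node → Info
  /-- the player moving at an information set -/
  player : Info → Player
  /-- the set of moves available at an information set -/
  avail : Info → Finset Move
  avail_nonempty : ∀ h, (avail h).Nonempty
  /-- moves are in bijection with immediate successors -/
  child_exists : ∀ n, decision n → ∀ a ∈ avail (info n), ∃! n', parentMove n' = some (n, a)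
  parent_decision : ∀ n' n a, parentMove n' = some (n, a) → decision n ∧ a ∈ avail (info n)
  /-- information sets partition the set of decision nodes -/
  info_surjOn_decision : ∀ h, ∃ n, decision n ∧ info n = h
  root_decision : decision root
  /-- the information set of the root is the singleton {root} -/
  root_info_singleton : ∀ n, decision n → info n = info root → n = root
  exists_terminal : ∃ n, ¬ decision n

namespace ExtGame

variable (G : ExtGame)

instance : Fintype G.Node := G.nodeFintype
instance : DecidableEq G.Node := G.nodeDecEq
instance : Fintype G.Move := G.moveFintype
instance : DecidableEq G.Move := G.moveDecEq
instance : Fintype G.Info := G.infoFintype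
instance : DecidableEq G.Info := G.infoDecEq
instance : Fintype G.Player := G.playerFintype
instance : DecidableEq G.Player := G.playerDecEq

/-- auxiliary, fuel-based computation of the list of (information set, move) pairs
crossed on the unique path from the root to a node -/
def pathAux : ℕ → G.Node → List (G.Info × G.Move)
  | 0, _ => []
  | fuel + 1, n =>
    match G.parentMove n with
    | none => []
    | some (m, a) => pathAux fuel m ++ [(G.info m, a)]

/-- the list of (information set, move) pairs crossed on the unique path from the
root to a node; since `rank` increases by exactly one along each edge, the fuel
`G.rank n` is always sufficient -/
def pathPairs (n : G.Node) : List (G.Info × G.Move) := G.pathAux (G.rank n) n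

/-- `(h, a) ⊑ n` : the path from the root to `n` goes through `h`, taking move `a` -/
def chooses (h : G.Info) (a : G.Move) (n : G.Node) : Prop := (h, a) ∈ G.pathPairs n

/-- `h ⊑ n` : the path from the root to `n` goes through the information set `h` -/
def visits (h : G.Info) (n : G.Node) : Prop := ∃ a, G.chooses h a n

/-- terminal nodes -/
def terminalSet : Finset G.Node := Finset.univ.filter fun n => ¬ G.decision n

/-- a behavioral strategy profile: a probability distribution on `avail h` for each
information set `h` -/
def IsProfile (g : G.Info → G.Move → ℝ) : Prop :=
  (∀ h a, 0 ≤ g h a) ∧ (∀ h, ∑ a ∈ G.avail h, g h a = 1) ∧ ∀ h a, a ∉ G.avail h → g h a = 0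

/-- probability of reaching node `n` under profile `g` -/
def reachProb (g : G.Info → G.Move → ℝ) (n : G.Node) : ℝ :=
  ((G.pathPairs n).map fun p => g p.1 p.2).prod

/-- expected payoff (for payoff function `u` on terminal nodes) under profile `g` -/
def eu (u : G.Node → ℝ) (g : G.Info → G.Move → ℝ) : ℝ :=
  ∑ z ∈ G.terminalSet, u z * G.reachProb g z

/-- `(a, g^{-h})` : the profile `g` with `g (·|h)` replaced by the point mass at `a` -/
def replace (g : G.Info → G.Move → ℝ) (h : G.Info) (a : G.Move) : G.Info → G.Move → ℝ :=
  fun h' b => if h' = h then (if b = a then 1 else 0) else g h' b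

/-- `max_{a ∈ A^h} u(a, g^{-h})` -/
def brMax (u : G.Node → ℝ) (g : G.Info → G.Move → ℝ) (h : G.Info) : ℝ :=
  ((G.avail h).image fun a => G.eu u (G.replace g h a)).max' ((G.avail_nonempty h).image _)

/-- the move `a` is a (local) best reply at `h` against `g` -/
def IsBR (u : G.Node → ℝ) (g : G.Info → G.Move → ℝ) (h : G.Info) (a : G.Move) : Prop :=
  a ∈ G.avail h ∧ G.eu u (G.replace g h a) = G.brMax u g h

/-- the optimality gap `V_g(h)` of the profile `g` at the information set `h`,
for the payoff function `u` of the player moving at `h` -/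
def gap (u : G.Node → ℝ) (g : G.Info → G.Move → ℝ) (h : G.Info) : ℝ :=
  G.brMax u g h - G.eu u g

/-- the experience of player `i` on the path to a node: the information sets of `i`
crossed and the moves taken there -/
def experience (i : G.Player) (n : G.Node) : List (G.Info × G.Move) :=
  (G.pathPairs n).filter fun p => G.player p.1 = i

/-- perfect recall: two nodes in the same information set give its player identical
experiences -/
def PerfectRecall : Prop :=
  ∀ n m : G.Node, G.decision n → G.decision m → G.info n = G.info m →
    G.experience (G.player (G.info n)) n = G.experience (G.player (G.info n)) m

/-- indicator `I_t(h)` that the information set `h` is visited on the path to `n` -/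
def visitInd (h : G.Info) (n : G.Node) : ℝ := if G.visits h n then 1 else 0

/-- indicator `I_t(a)` that the move `a` is chosen at `h` on the path to `n` -/
def chooseInd (h : G.Info) (a : G.Move) (n : G.Node) : ℝ := if G.chooses h a n then 1 else 0

/-- `#_t(h)` : the number of rounds `1,…,t` in which `h` is visited -/
def visitCount (z : ℕ → G.Node) (t : ℕ) (h : G.Info) : ℝ :=
  ∑ k ∈ Finset.Icc 1 t, G.visitInd h (z k)

/-- The fictitious play process: in round `t = 1,2,…` the play path reaches the
terminal node `z t`; `f t` are the empirical frequencies entering round `t`;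
every move made on the realized path is a local best reply against `f t`. -/
structure IsFP (payoff : G.Player → G.Node → ℝ) (f : ℕ → G.Info → G.Move → ℝ)
    (z : ℕ → G.Node) : Prop where
  profile : ∀ t, 1 ≤ t → G.IsProfile (f t)
  terminal : ∀ t, 1 ≤ t → ¬ G.decision (z t)
  update : ∀ t, 1 ≤ t → ∀ h a,
    f (t + 1) h a = f t h a +
      G.visitInd h (z t) / G.visitCount z t h * (G.chooseInd h a (z t) - f t h a)
  bestReply : ∀ t, 1 ≤ t → ∀ h a, G.chooses h a (z t) →
    G.eu (payoff (G.player h)) (G.replace (f t) h a) = G.brMax (payoff (G.player h)) (f t) h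

end ExtGame

namespace ExtGame

/-- the increment `δ_t(a|h) = (I_t(h)/#_t(h)) (I_t(a) − f_t(a|h))` of the empirical
frequencies in fictitious play -/
def fpDelta (G : ExtGame) (f : ℕ → G.Info → G.Move → ℝ) (z : ℕ → G.Node) (t : ℕ)
    (h : G.Info) (a : G.Move) : ℝ :=
  G.visitInd h (z t) / G.visitCount z t h * (G.chooseInd h a (z t) - f t h a)

/-- the second-order remainder
`ε_t = Σ_z u(z) Σ_{J ⊆ [1,ℓ_z), |J| ≥ 2} ∏_{ℓ∈J} δ_t(n_{ℓ+1}|h(n_ℓ)) ∏_{ℓ∉J} f_t(n_{ℓ+1}|h(n_ℓ))` -/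
def fpEps (G : ExtGame) (u : G.Node → ℝ) (f : ℕ → G.Info → G.Move → ℝ) (z : ℕ → G.Node)
    (t : ℕ) : ℝ :=
  ∑ zz ∈ G.terminalSet, u zz *
    ∑ J ∈ (Finset.univ : Finset (Finset (Fin (G.pathPairs zz).length))).filter
        (fun J => 2 ≤ J.card),
      (∏ j ∈ J, G.fpDelta f z t ((G.pathPairs zz).get j).1 ((G.pathPairs zz).get j).2) *
        ∏ j ∈ Jᶜ, f t ((G.pathPairs zz).get j).1 ((G.pathPairs zz).get j).2

end ExtGame

namespace ExtGame

section PathPairs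

variable (G : ExtGame)

theorem pathPairs_of_parentMove_eq_none {n : G.Node} (hn : G.parentMove n = none) :
    G.pathPairs n = [] := by
  unfold pathPairs
  cases G.rank n <;> simp [pathAux, hn]

theorem pathPairs_of_parentMove_eq_some {n m : G.Node} {a : G.Move}
    (hn : G.parentMove n = some (m, a)) :
    G.pathPairs n = G.pathPairs m ++ [(G.info m, a)] := by
  unfold pathPairs
  rw [G.rank_succ n m a hn]
  simp [pathAux, hn]

/-- Induction along the edges of the tree. -/
theorem node_induction {p : G.Node → Prop} (hroot : ∀ n, G.parentMove n = none → p n)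
    (hstep : ∀ n m a, G.parentMove n = some (m, a) → p m → p n) (n : G.Node) : p n := by
  induction hk : G.rank n using Nat.strong_induction_on generalizing n with
  | _ k ih =>
    rcases hn : G.parentMove n with _ | ⟨m, a⟩
    · exact hroot n hn
    · have hr := G.rank_succ n m a hn
      exact hstep n m a hn (ih (G.rank m) (by omega) m rfl)

theorem exists_prefix_of_chooses {h : G.Info} {b : G.Move} (n : G.Node)
    (hn : G.chooses h b n) :
    ∃ m, G.decision m ∧ G.info m = h ∧ G.pathPairs m ++ [(h, b)] <+: G.pathPairs n := by
  unfold chooses at hn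
  induction n using G.node_induction with
  | hroot n h0 => simp [G.pathPairs_of_parentMove_eq_none h0] at hn
  | hstep n m a h1 ih =>
    rw [G.pathPairs_of_parentMove_eq_some h1] at hn ⊢
    rcases List.mem_append.1 hn with hm | hm
    · obtain ⟨m', hd, hi, hp⟩ := ih hm
      exact ⟨m', hd, hi, hp.trans (List.prefix_append _ _)⟩
    · obtain ⟨rfl, rfl⟩ := Prod.mk.inj (List.mem_singleton.1 hm)
      exact ⟨m, (G.parent_decision n m b h1).1, rfl, List.prefix_rfl⟩

variable {G}

theorem PerfectRecall.not_visits_info (hPR : G.PerfectRecall) {n : G.Node}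
    (hn : G.decision n) : ¬ G.visits (G.info n) n := by
  rintro ⟨b, hb⟩
  obtain ⟨m, hd, hi, hp⟩ := G.exists_prefix_of_chooses n hb
  have he := hPR m n hd hn hi
  have hl := (hp.filter fun p => G.player p.1 = G.player (G.info m)).length_le
  unfold experience at he
  simp only [List.filter_append, List.length_append, he] at hl
  simp [hi] at hl

/-- Under perfect recall no information set is crossed twice on a path. -/
theorem PerfectRecall.nodup_pathPairs (hPR : G.PerfectRecall) (n : G.Node) :
    ((G.pathPairs n).map Prod.fst).Nodup := by
  induction n using G.node_induction with
  | hroot n h0 => simp [G.pathPairs_of_parentMove_eq_none h0]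
  | hstep n m a h1 ih =>
    have hm := hPR.not_visits_info (G.parent_decision n m a h1).1
    rw [G.pathPairs_of_parentMove_eq_some h1, List.map_append, List.nodup_append]
    refine ⟨ih, by simp, ?_⟩
    rintro h hh h' hh' rfl
    obtain ⟨⟨h₁, b⟩, hb, rfl⟩ := List.mem_map.1 hh
    obtain rfl : h₁ = G.info m := by simpa using hh'
    exact hm ⟨b, hb⟩

theorem PerfectRecall.injective_fst_get (hPR : G.PerfectRecall) (n : G.Node) :
    Function.Injective fun j => ((G.pathPairs n).get j).1 := by
  intro i j hij
  have h := List.nodup_iff_injective_get.1 (hPR.nodup_pathPairs n)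
  have := @h (i.cast (by simp)) (j.cast (by simp)) (by simpa using hij)
  simpa [Fin.ext_iff] using this

theorem PerfectRecall.chooses_unique (hPR : G.PerfectRecall) {n : G.Node} {h : G.Info}
    {a b : G.Move} (ha : G.chooses h a n) (hb : G.chooses h b n) : a = b := by
  have := List.inj_on_of_nodup_map (hPR.nodup_pathPairs n) ha hb rfl
  exact (Prod.mk.inj this).2

theorem reachProb_eq_prod (g : G.Info → G.Move → ℝ) (n : G.Node) :
    G.reachProb g n =
      ∏ j, g ((G.pathPairs n).get j).1 ((G.pathPairs n).get j).2 :=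
  (Fin.prod_univ_fun_getElem (G.pathPairs n) fun p => g p.1 p.2).symm

end PathPairs

section Expansion

/-- Splitting a sum over subsets by cardinality zero, one, and at least two. -/
theorem sum_finset_eq_empty_add_singleton_add {ι : Type*} [Fintype ι] [DecidableEq ι] (F : Finset ι → ℝ) :
    ∑ J, F J = F ∅ + ∑ j, F {j} + ∑ J with 2 ≤ J.card, F J := by
  rw [← Finset.sum_filter_add_sum_filter_not Finset.univ (fun J : Finset ι => 2 ≤ J.card),
    add_comm]
  congr 1
  have hs : (Finset.univ.filter fun J : Finset ι => ¬ 2 ≤ J.card) =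
      insert ∅ (Finset.univ.image fun j : ι => ({j} : Finset ι)) := by
    ext J
    have hJ : ¬ 2 ≤ J.card ↔ J.card = 0 ∨ J.card = 1 := by omega
    rw [Finset.mem_filter, hJ, Finset.card_eq_zero, Finset.card_eq_one]
    simp [eq_comm]
  rw [hs, Finset.sum_insert (by simp),
    Finset.sum_image fun i _ j _ hij => Finset.singleton_injective hij]

theorem prod_add_eq_expansion {ι : Type*} [Fintype ι] [DecidableEq ι] (d g : ι → ℝ) :
    ∏ j, (g j + d j) = ∏ j, g j + ∑ j, d j * ∏ i ∈ {j}ᶜ, g i +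
      ∑ J with 2 ≤ J.card, (∏ j ∈ J, d j) * ∏ j ∈ Jᶜ, g j := by
  have h : ∏ j, (g j + d j) = ∑ J : Finset ι, (∏ j ∈ J, d j) * ∏ j ∈ Jᶜ, g j := by
    simp_rw [add_comm (g _), Finset.prod_add, Finset.powerset_univ, Finset.compl_eq_univ_sdiff]
  rw [h, sum_finset_eq_empty_add_singleton_add]
  simp

variable {G : ExtGame}

/-- The first-order part of the change of a reaching probability, when the profile `g` moves at
each information set `h` by a fraction `x h` towards the move `c h`. -/
theorem PerfectRecall.sum_first_order (hPR : G.PerfectRecall) (g d : G.Info → G.Move → ℝ)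
    (x : G.Info → ℝ) (c : G.Info → G.Move)
    (hd : ∀ h b, d h b = x h * ((if b = c h then 1 else 0) - g h b)) (n : G.Node) :
    ∑ j, d ((G.pathPairs n).get j).1 ((G.pathPairs n).get j).2 *
        ∏ i ∈ {j}ᶜ, g ((G.pathPairs n).get i).1 ((G.pathPairs n).get i).2 =
      ∑ h, x h * (G.reachProb (G.replace g h (c h)) n - G.reachProb g n) := by
  have hinj := hPR.injective_fst_get n
  simp_rw [reachProb_eq_prod]
  refine Fintype.sum_of_injective _ hinj _ _ (fun h hh => ?_) fun j => ?_
  · have : ∀ i, ((G.pathPairs n).get i).1 ≠ h := fun i hi => hh ⟨i, hi⟩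
    simp only [replace, this, if_false, sub_self, mul_zero]
  · have hne : ∀ i ∈ ({j} : Finset _)ᶜ,
        G.replace g ((G.pathPairs n).get j).1 (c ((G.pathPairs n).get j).1)
          ((G.pathPairs n).get i).1 ((G.pathPairs n).get i).2 =
        g ((G.pathPairs n).get i).1 ((G.pathPairs n).get i).2 := by
      intro i hi
      have : ((G.pathPairs n).get i).1 ≠ ((G.pathPairs n).get j).1 := fun h =>
        (Finset.mem_compl.1 hi) (Finset.mem_singleton.2 (hinj h))
      simp only [replace, this, if_false]
    rw [Fintype.prod_eq_mul_prod_compl j, Finset.prod_congr rfl hne,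
      Fintype.prod_eq_mul_prod_compl j
        (fun i => g ((G.pathPairs n).get i).1 ((G.pathPairs n).get i).2), hd]
    simp only [replace, if_true]
    ring

end Expansion

section FictitiousPlay

variable {G : ExtGame}

theorem visitInd_nonneg (h : G.Info) (n : G.Node) : 0 ≤ G.visitInd h n := by
  unfold visitInd; split_ifs <;> norm_num

theorem visitCount_nonneg (z : ℕ → G.Node) (t : ℕ) (h : G.Info) : 0 ≤ G.visitCount z t h :=
  Finset.sum_nonneg fun _ _ => visitInd_nonneg h _

theorem visitCount_succ (z : ℕ → G.Node) (t : ℕ) (h : G.Info) :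
    G.visitCount z (t + 1) h = G.visitCount z t h + G.visitInd h (z (t + 1)) :=
  Finset.sum_Icc_succ_top (by omega) _

theorem visitRate_nonneg (z : ℕ → G.Node) (t : ℕ) (h : G.Info) :
    0 ≤ G.visitInd h (z t) / G.visitCount z t h :=
  div_nonneg (visitInd_nonneg h _) (visitCount_nonneg z t h)

theorem visitRate_le_one (z : ℕ → G.Node) {t : ℕ} (ht : 1 ≤ t) (h : G.Info) :
    G.visitInd h (z t) / G.visitCount z t h ≤ 1 :=
  div_le_one_of_le₀
    (Finset.single_le_sum (f := fun k => G.visitInd h (z k))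
      (fun _ _ => visitInd_nonneg h _) (Finset.mem_Icc.2 ⟨ht, le_rfl⟩))
    (visitCount_nonneg z t h)

theorem sum_visitRate_sq_le (z : ℕ → G.Node) (h : G.Info) (T : ℕ) :
    ∑ t ∈ Finset.range T, (G.visitInd h (z (t + 1)) / G.visitCount z (t + 1) h) ^ 2 ≤
      2 - 2 / (G.visitCount z T h + 1) := by
  induction T with
  | zero => simp [visitCount]
  | succ T ih =>
    rw [Finset.sum_range_succ, visitCount_succ]
    have hN := visitCount_nonneg z T h
    rcases eq_or_ne (G.visitInd h (z (T + 1))) 0 with h0 | h0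
    · simpa [h0] using ih
    · have h1 : G.visitInd h (z (T + 1)) = 1 := by
        unfold visitInd at h0 ⊢; split_ifs at h0 ⊢ <;> simp_all
      rw [h1]
      set N := G.visitCount z T h
      have key : (1 / (N + 1)) ^ 2 ≤ 2 / (N + 1) - 2 / (N + 1 + 1) := by
        have : 2 / (N + 1) - 2 / (N + 1 + 1) - (1 / (N + 1)) ^ 2 =
            N / ((N + 1) ^ 2 * (N + 1 + 1)) := by
          field_simp; ring
        have : 0 ≤ N / ((N + 1) ^ 2 * (N + 1 + 1)) := by positivity
        linarith
      linarith

theorem summable_visitRate_sq (z : ℕ → G.Node) (h : G.Info) :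
    Summable fun t => (G.visitInd h (z (t + 1)) / G.visitCount z (t + 1) h) ^ 2 := by
  refine summable_of_sum_range_le (c := 2) (fun _ => sq_nonneg _) fun T =>
    (sum_visitRate_sq_le z h T).trans ?_
  have := visitCount_nonneg z T h
  have : 0 ≤ 2 / (G.visitCount z T h + 1) := by positivity
  linarith

theorem IsProfile.le_one {g : G.Info → G.Move → ℝ} (hg : G.IsProfile g) (h : G.Info)
    (a : G.Move) : g h a ≤ 1 := by
  by_cases ha : a ∈ G.avail h
  · rw [← hg.2.1 h]
    exact Finset.single_le_sum (fun b _ => hg.1 h b) ha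
  · rw [hg.2.2 h a ha]; exact zero_le_one

theorem abs_fpDelta_le {f : ℕ → G.Info → G.Move → ℝ} (z : ℕ → G.Node) {t : ℕ}
    (hf : G.IsProfile (f t)) (h : G.Info) (a : G.Move) :
    |G.fpDelta f z t h a| ≤ G.visitInd h (z t) / G.visitCount z t h := by
  have h0 := hf.1 h a
  have h1 := hf.le_one h a
  have : |G.chooseInd h a (z t) - f t h a| ≤ 1 := by
    unfold chooseInd
    rw [abs_le]
    split_ifs <;> constructor <;> linarith
  rw [fpDelta, abs_mul, abs_of_nonneg (visitRate_nonneg z t h)]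
  exact mul_le_of_le_one_right (visitRate_nonneg z t h) this

/-- Products of at least two increments are dominated by the sum of squared visit rates. -/
theorem abs_prod_fpDelta_mul_prod_le {f : ℕ → G.Info → G.Move → ℝ} (z : ℕ → G.Node) {t : ℕ}
    (ht : 1 ≤ t) (hf : G.IsProfile (f t)) {ι : Type*} [Fintype ι] [DecidableEq ι] (p : ι → G.Info × G.Move)
    {J : Finset ι} (hJ : 2 ≤ J.card) :
    |(∏ j ∈ J, G.fpDelta f z t (p j).1 (p j).2) * ∏ j ∈ Jᶜ, f t (p j).1 (p j).2| ≤
      ∑ h, (G.visitInd h (z t) / G.visitCount z t h) ^ 2 := by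
  set x : G.Info → ℝ := fun h => G.visitInd h (z t) / G.visitCount z t h
  have hx : ∀ h, x h ^ 2 ≤ ∑ h, x h ^ 2 := fun h =>
    Finset.single_le_sum (f := fun h => x h ^ 2) (fun _ _ => sq_nonneg _) (Finset.mem_univ h)
  obtain ⟨i, hi, k, hk, hik⟩ := Finset.one_lt_card.1 hJ
  have hd : ∏ j ∈ J, |G.fpDelta f z t (p j).1 (p j).2| ≤ x (p i).1 * x (p k).1 := by
    calc ∏ j ∈ J, |G.fpDelta f z t (p j).1 (p j).2|
        ≤ ∏ j ∈ J, x (p j).1 :=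
          Finset.prod_le_prod (fun _ _ => abs_nonneg _) fun j _ => abs_fpDelta_le z hf _ _
      _ ≤ ∏ j ∈ {i, k}, x (p j).1 :=
          Finset.prod_le_prod_of_subset_of_le_one
            (by simp [Finset.insert_subset_iff, hi, hk])
            (fun j _ => visitRate_nonneg z t _) fun j _ _ => visitRate_le_one z ht _
      _ = x (p i).1 * x (p k).1 := Finset.prod_pair hik
  have hg : ∏ j ∈ Jᶜ, |f t (p j).1 (p j).2| ≤ 1 :=
    Finset.prod_le_one (fun _ _ => abs_nonneg _) fun j _ => by
      rw [abs_of_nonneg (hf.1 _ _)]; exact hf.le_one _ _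
  rw [abs_mul, Finset.abs_prod, Finset.abs_prod]
  refine (mul_le_of_le_one_right (Finset.prod_nonneg fun _ _ => abs_nonneg _) hg).trans
    (hd.trans ?_)
  nlinarith [hx (p i).1, hx (p k).1, sq_nonneg (x (p i).1 - x (p k).1)]

theorem abs_fpEps_le (u : G.Node → ℝ) {f : ℕ → G.Info → G.Move → ℝ} (z : ℕ → G.Node) {t : ℕ}
    (ht : 1 ≤ t) (hf : G.IsProfile (f t)) :
    |G.fpEps u f z t| ≤
      (∑ n ∈ G.terminalSet, |u n| * 2 ^ (G.pathPairs n).length) *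
        ∑ h, (G.visitInd h (z t) / G.visitCount z t h) ^ 2 := by
  set S := ∑ h, (G.visitInd h (z t) / G.visitCount z t h) ^ 2
  have hS : 0 ≤ S := Finset.sum_nonneg fun _ _ => sq_nonneg _
  rw [fpEps, Finset.sum_mul]
  refine (Finset.abs_sum_le_sum_abs _ _).trans (Finset.sum_le_sum fun n _ => ?_)
  rw [abs_mul, mul_assoc]
  refine mul_le_mul_of_nonneg_left ?_ (abs_nonneg _)
  have hcard : (Finset.univ.filter fun J : Finset (Fin (G.pathPairs n).length) =>
      2 ≤ J.card).card ≤ 2 ^ (G.pathPairs n).length := by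
    simpa using Finset.card_filter_le
      (Finset.univ : Finset (Finset (Fin (G.pathPairs n).length))) fun J => 2 ≤ J.card
  refine (Finset.abs_sum_le_sum_abs _ _).trans
    ((Finset.sum_le_card_nsmul _ _ S fun J hJ => ?_).trans ?_)
  · exact abs_prod_fpDelta_mul_prod_le z ht hf (fun j => (G.pathPairs n).get j)
      (Finset.mem_filter.1 hJ).2
  · rw [nsmul_eq_mul]
    exact mul_le_mul_of_nonneg_right (mod_cast hcard) hS

theorem IsFP.summable_abs_fpEps {payoff : G.Player → G.Node → ℝ}
    {f : ℕ → G.Info → G.Move → ℝ} {z : ℕ → G.Node} (hFP : G.IsFP payoff f z)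
    (u : G.Node → ℝ) : Summable fun t => |G.fpEps u f z t| := by
  rw [← summable_nat_add_iff 1]
  exact Summable.of_nonneg_of_le (fun _ => abs_nonneg _)
    (fun t => abs_fpEps_le u z (Nat.le_add_left 1 t) (hFP.profile _ (Nat.le_add_left 1 t)))
    ((summable_sum fun h _ => summable_visitRate_sq z h).mul_left _)

theorem IsFP.eu_succ_sub_eu {u : G.Node → ℝ} (hPR : G.PerfectRecall)
    {f : ℕ → G.Info → G.Move → ℝ} {z : ℕ → G.Node} (hFP : G.IsFP (fun _ => u) f z) {t : ℕ}
    (ht : 1 ≤ t) :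
    G.eu u (f (t + 1)) - G.eu u (f t) =
      (∑ h, G.visitInd h (z t) / G.visitCount z t h * G.gap u (f t) h) + G.fpEps u f z t := by
  have hc : ∀ h, ∃ c, G.visits h (z t) → G.chooses h c (z t) := fun h => by
    by_cases hv : G.visits h (z t)
    · exact hv.imp fun a ha _ => ha
    · exact ⟨(G.avail_nonempty h).choose, fun h' => absurd h' hv⟩
  choose c hc using hc
  have hd : ∀ h b, G.fpDelta f z t h b = G.visitInd h (z t) / G.visitCount z t h *
      ((if b = c h then 1 else 0) - f t h b) := by
    intro h b
    by_cases hv : G.visits h (z t)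
    · have : G.chooses h b (z t) ↔ b = c h :=
        ⟨fun hb => hPR.chooses_unique hb (hc h hv), fun hb => hb ▸ hc h hv⟩
      simp [fpDelta, chooseInd, this]
    · simp [fpDelta, visitInd, hv]
  have hgap : ∀ h, G.visitInd h (z t) / G.visitCount z t h * G.gap u (f t) h =
      G.visitInd h (z t) / G.visitCount z t h *
        (G.eu u (G.replace (f t) h (c h)) - G.eu u (f t)) := by
    intro h
    by_cases hv : G.visits h (z t)
    · rw [gap, hFP.bestReply t ht h (c h) (hc h hv)]
    · simp [visitInd, hv]
  have hreach : ∀ n, G.reachProb (f (t + 1)) n = G.reachProb (f t) n +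
      ∑ h, G.visitInd h (z t) / G.visitCount z t h *
        (G.reachProb (G.replace (f t) h (c h)) n - G.reachProb (f t) n) +
      ∑ J with 2 ≤ J.card,
        (∏ j ∈ J, G.fpDelta f z t ((G.pathPairs n).get j).1 ((G.pathPairs n).get j).2) *
          ∏ j ∈ Jᶜ, f t ((G.pathPairs n).get j).1 ((G.pathPairs n).get j).2 := by
    intro n
    rw [← hPR.sum_first_order (f t) (G.fpDelta f z t) _ c hd n, reachProb_eq_prod,
      reachProb_eq_prod]
    exact (Finset.prod_congr rfl fun j _ => hFP.update t ht _ _).trans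
      (prod_add_eq_expansion _ fun j => f t ((G.pathPairs n).get j).1 ((G.pathPairs n).get j).2)
  have hfirst : ∑ h, G.visitInd h (z t) / G.visitCount z t h *
        (G.eu u (G.replace (f t) h (c h)) - G.eu u (f t)) =
      ∑ n ∈ G.terminalSet, u n * ∑ h, G.visitInd h (z t) / G.visitCount z t h *
        (G.reachProb (G.replace (f t) h (c h)) n - G.reachProb (f t) n) := by
    simp_rw [eu, ← Finset.sum_sub_distrib, Finset.mul_sum]
    rw [Finset.sum_comm]
    exact Finset.sum_congr rfl fun n _ => Finset.sum_congr rfl fun h _ => by ring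
  simp_rw [hgap]
  rw [hfirst, fpEps, eu, eu, ← Finset.sum_sub_distrib, ← Finset.sum_add_distrib]
  refine Finset.sum_congr rfl fun n _ => ?_
  rw [hreach n]
  ring

end FictitiousPlay

end ExtGame

open ExtGame

/-- Along any play path of fictitious play in a game with identical
interests, the one-round change of the expected common payoff decomposes as
`u(f_{t+1}) − u(f_t) = Σ_h (I_t(h)/#_t(h)) V_{f_t}(h) + ε_t`, and `Σ_t |ε_t| < ∞`. -/
theorem fp_payoff_decomposition (G : ExtGame)
    (u : G.Node → ℝ) (hPR : G.PerfectRecall)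
    (f : ℕ → G.Info → G.Move → ℝ) (z : ℕ → G.Node)
    (hFP : G.IsFP (fun _ => u) f z) :
    (∀ t : ℕ, 1 ≤ t →
      G.eu u (f (t + 1)) - G.eu u (f t) =
        (∑ h : G.Info, G.visitInd h (z t) / G.visitCount z t h * G.gap u (f t) h) +
          G.fpEps u f z t) ∧
    Summable fun t => |G.fpEps u f z t| :=
  ⟨fun _ ht => hFP.eu_succ_sub_eu hPR ht, hFP.summable_abs_fpEps u⟩
end
end

section
/- Under FP with inertia and fading memory in a common-payoff game with pairwise-distinct terminal payoffs, the largest integer n ∈ ℕ_0 for which the event Ê_{t_0} ∩ Ê_{t_1} ∩ … ∩ Ê_{t_n} (with t_{ℓ+1} := t_ℓ + K_{t_ℓ} + m_{t_ℓ} + 1 and m_{t_0},…,m_{t_n} < ∞) can occur is bounded by n < (|Z| − 1)|Z|, where |Z| is the number of terminal nodes. -/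
open Classical Filter MeasureTheory
open scoped BigOperators

noncomputable section

namespace ExtGame

/-- the deterministic fading-memory update map `𝔉₁(·, z)`:
`g(a|h) ↦ g(a|h) + ρ I(h)(I(a) − g(a|h))` for the play path reaching `zz` -/
def fadeStep (G : ExtGame) (ρ : ℝ) (zz : G.Node) (g : G.Info → G.Move → ℝ) :
    G.Info → G.Move → ℝ :=
  fun h a => g h a + ρ * G.visitInd h zz * (G.chooseInd h a zz - g h a)

/-- `(g, zz)` is an `ℓ`-step locked state: every move on the path to `zz` stays a
best reply for `ℓ` further fading-memory updates -/
def LockedUpTo (G : ExtGame) (u : G.Node → ℝ) (ρ : ℝ) (ℓ : ℕ)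
    (g : G.Info → G.Move → ℝ) (zz : G.Node) : Prop :=
  ∀ p ∈ G.pathPairs zz, ∀ m : ℕ, 1 ≤ m → m ≤ ℓ →
    G.IsBR u ((G.fadeStep ρ zz)^[m] g) p.1 p.2

/-- `(g, zz)` is a locked state -/
def Locked (G : ExtGame) (u : G.Node → ℝ) (ρ : ℝ)
    (g : G.Info → G.Move → ℝ) (zz : G.Node) : Prop :=
  ∀ p ∈ G.pathPairs zz, ∀ m : ℕ, 1 ≤ m →
    G.IsBR u ((G.fadeStep ρ zz)^[m] g) p.1 p.2

/-- `u_max := max_{z ∈ Z} |u(z)|` -/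
def umax (G : ExtGame) (u : G.Node → ℝ) : ℝ :=
  sSup {x : ℝ | ∃ zz ∈ G.terminalSet, x = |u zz|}

/-- `Δ_min := min_{z ≠ z̄} |u(z) − u(z̄)|` -/
def dmin (G : ExtGame) (u : G.Node → ℝ) : ℝ :=
  sInf {x : ℝ | ∃ zz ∈ G.terminalSet, ∃ zz' ∈ G.terminalSet, zz ≠ zz' ∧ x = |u zz - u zz'|}

/-- `L_max`: the maximum number of moves on any root-to-terminal path -/
def lmax (G : ExtGame) : ℕ := G.terminalSet.sup fun zz => (G.pathPairs zz).length

/-- the threshold `(1 − Δ_min/(8 u_max))^{1/L_max}` -/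
def thr (G : ExtGame) (u : G.Node → ℝ) : ℝ :=
  (1 - G.dmin u / (8 * G.umax u)) ^ ((G.lmax : ℝ)⁻¹)

/-- `K_max`: the smallest integer with `1 − (1−ρ)^{K+1} ≥ (1 − Δ_min/(8u_max))^{1/L_max}` -/
def Kmax (G : ExtGame) (u : G.Node → ℝ) (ρ : ℝ) : ℕ :=
  sInf {K : ℕ | G.thr u ≤ 1 - (1 - ρ) ^ (K + 1)}

/-- `K_t`: the smallest integer such that `K_t + 1` repetitions of `z_t` push all
empirical frequencies on its path above the threshold -/
def Kt (G : ExtGame) (u : G.Node → ℝ) (ρ : ℝ) (f : ℕ → G.Info → G.Move → ℝ)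
    (z : ℕ → G.Node) (t : ℕ) : ℕ :=
  sInf {K : ℕ | ∀ p ∈ G.pathPairs (z t),
    G.thr u ≤ (1 - ρ) ^ (K + 1) * f t p.1 p.2 + 1 - (1 - ρ) ^ (K + 1)}

/-- `m_t ∈ ℕ∞`: the smallest `m` with `(𝔉_{K_t}(f_t,z_t), z_t) ∉ Λ_{m+1}`
(`⊤` if `(𝔉_{K_t}(f_t,z_t), z_t)` is a locked state) -/
def mt (G : ExtGame) (u : G.Node → ℝ) (ρ : ℝ) (f : ℕ → G.Info → G.Move → ℝ)
    (z : ℕ → G.Node) (t : ℕ) : ℕ∞ :=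
  ⨅ (m : ℕ) (_ : ¬ G.LockedUpTo u ρ (m + 1)
      ((G.fadeStep ρ (z t))^[G.Kt u ρ f z t] (f t)) (z t)), (m : ℕ∞)

/-- the repeat event `E_t = {z_t = z_{t+1} = … = z_{t+K_t}}` -/
def repeatEvent (G : ExtGame) (u : G.Node → ℝ) (ρ : ℝ) (f : ℕ → G.Info → G.Move → ℝ)
    (z : ℕ → G.Node) (t : ℕ) : Prop :=
  ∀ k ≤ G.Kt u ρ f z t, z (t + k) = z t

/-- `s_t := t + K_t + m_t`, the last round of the forced repetitions -/
def st (G : ExtGame) (u : G.Node → ℝ) (ρ : ℝ) (f : ℕ → G.Info → G.Move → ℝ)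
    (z : ℕ → G.Node) (t : ℕ) : ℕ :=
  t + G.Kt u ρ f z t + (G.mt u ρ f z t).toNat

/-- the repeat-lock event `Ē_t` -/
def repeatLockEvent (G : ExtGame) (u : G.Node → ℝ) (ρ : ℝ)
    (f : ℕ → G.Info → G.Move → ℝ) (z : ℕ → G.Node) (t : ℕ) : Prop :=
  if G.mt u ρ f z t = ⊤ then ∀ τ, t ≤ τ → z τ = z t
  else ∀ k ≤ G.Kt u ρ f z t + (G.mt u ρ f z t).toNat, z (t + k) = z t

/-- `Ẑ_{s_t+1}`: the terminal nodes reachable from `z_{s_t}` by deviating at a single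
information set on its path to a strictly improving move while repeating all other
previous moves -/
def devSet (G : ExtGame) (u : G.Node → ℝ) (ρ : ℝ) (f : ℕ → G.Info → G.Move → ℝ)
    (z : ℕ → G.Node) (A : ℕ → G.Info → G.Move) (t : ℕ) : Set G.Node :=
  {z' | ¬ G.decision z' ∧ ∃ hbar abar ahat, (hbar, abar) ∈ G.pathPairs (z (G.st u ρ f z t)) ∧
    ahat ∈ G.avail hbar ∧
    G.eu u (G.replace (f (G.st u ρ f z t + 1)) hbar abar) <
      G.eu u (G.replace (f (G.st u ρ f z t + 1)) hbar ahat) ∧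
    ∀ p ∈ G.pathPairs z', p.2 = if p.1 = hbar then ahat else A (G.st u ρ f z t) p.1}

/-- the repeat-lock-deviate event `Ê_t` -/
def deviateEvent (G : ExtGame) (u : G.Node → ℝ) (ρ : ℝ) (f : ℕ → G.Info → G.Move → ℝ)
    (z : ℕ → G.Node) (A : ℕ → G.Info → G.Move) (t : ℕ) : Prop :=
  G.repeatLockEvent u ρ f z t ∧ z (G.st u ρ f z t + 1) ∈ G.devSet u ρ f z A t

/-- the sequence of rounds `t_0, t_1, …` with `t_{ℓ+1} = t_ℓ + K_{t_ℓ} + m_{t_ℓ} + 1` -/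
def tseq (G : ExtGame) (u : G.Node → ℝ) (ρ : ℝ) (f : ℕ → G.Info → G.Move → ℝ)
    (z : ℕ → G.Node) (t0 : ℕ) : ℕ → ℕ
  | 0 => t0
  | ℓ + 1 => G.st u ρ f z (tseq G u ρ f z t0 ℓ) + 1

/-- A possible trajectory of fictitious play with inertia (parameters `α h ∈ (0,1)`)
and fading memory (parameter `ρ ∈ (0,1)`) in the game `G` with common payoff `u`:
`f t` are the (fading-memory) empirical frequencies, `A t` is the pure profile of
round `t` (the most recent move at every information set), and `z t` is the terminal
node reached in round `t`. -/
structure IsFPInertiaPath (G : ExtGame) (u : G.Node → ℝ) (ρ : ℝ) (α : G.Info → ℝ)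
    (f : ℕ → G.Info → G.Move → ℝ) (A : ℕ → G.Info → G.Move) (z : ℕ → G.Node) :
    Prop where
  rho_mem : ρ ∈ Set.Ioo (0 : ℝ) 1
  alpha_mem : ∀ h, α h ∈ Set.Ioo (0 : ℝ) 1
  profile : ∀ t, 1 ≤ t → G.IsProfile (f t)
  pure_valid : ∀ t, 1 ≤ t → ∀ h, A t h ∈ G.avail h
  terminal : ∀ t, 1 ≤ t → ¬ G.decision (z t)
  outcome : ∀ t, 1 ≤ t → ∀ p ∈ G.pathPairs (z t), A t p.1 = p.2
  update : ∀ t, 1 ≤ t → f (t + 1) = G.fadeStep ρ (z t) (f t)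
  inertia_unreached : ∀ t, 2 ≤ t → ∀ h, ¬ G.visits h (z t) → A t h = A (t - 1) h
  inertia_br : ∀ t, 2 ≤ t → ∀ h, G.visits h (z t) →
    G.IsBR u (f t) h (A (t - 1) h) → A t h = A (t - 1) h
  inertia_switch : ∀ t, 2 ≤ t → ∀ h, G.visits h (z t) →
    ¬ G.IsBR u (f t) h (A (t - 1) h) →
    A t h = A (t - 1) h ∨ G.IsBR u (f t) h (A t h)

end ExtGame

open ExtGame

namespace ExtGame

lemma pathPairs_root (G : ExtGame) : G.pathPairs G.root = [] := by
  unfold pathPairs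
  cases G.rank G.root with
  | zero => rfl
  | succ k => simp [pathAux, G.parentMove_root]

lemma pathPairs_of_parentMove (G : ExtGame) {n m : G.Node} {a : G.Move}
    (h : G.parentMove n = some (m, a)) : G.pathPairs n = G.pathPairs m ++ [(G.info m, a)] := by
  unfold pathPairs
  rw [G.rank_succ n m a h]
  simp [pathAux, h]

lemma reachProb_of_parentMove (G : ExtGame) (g : G.Info → G.Move → ℝ) {n m : G.Node} {a : G.Move}
    (h : G.parentMove n = some (m, a)) :
    G.reachProb g n = G.reachProb g m * g (G.info m) a := by
  simp [reachProb, G.pathPairs_of_parentMove h]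

lemma reachProb_nonneg (G : ExtGame) {g : G.Info → G.Move → ℝ} (hg : G.IsProfile g) (n : G.Node) :
    0 ≤ G.reachProb g n := by
  refine List.prod_nonneg fun x hx => ?_
  obtain ⟨p, -, rfl⟩ := List.mem_map.1 hx
  exact hg.1 _ _

lemma mem_terminalSet (G : ExtGame) {n : G.Node} : n ∈ G.terminalSet ↔ ¬ G.decision n := by
  simp [terminalSet]

/-- The probabilities of the terminal nodes sum to one. -/
lemma sum_reachProb_terminalSet (G : ExtGame) {g : G.Info → G.Move → ℝ} (hg : G.IsProfile g) :
    ∑ z ∈ G.terminalSet, G.reachProb g z = 1 := by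
  let F : G.Node → G.Node × G.Move → ℝ := fun n p =>
    if G.parentMove n = some p then G.reachProb g p.1 * g (G.info p.1) p.2 else 0
  have h1 : ∀ n, ∑ p, F n p = G.reachProb g n - if n = G.root then 1 else 0 := by
    intro n
    rcases h : G.parentMove n with _ | ⟨m, a⟩
    · have hn := G.eq_root_of_parentMove_eq_none n h
      subst hn
      simp [F, h, reachProb, pathPairs_root]
    · have hn : n ≠ G.root := by
        rintro rfl
        simp [G.parentMove_root] at h
      simp only [F, h, Option.some.injEq, Finset.sum_ite_eq, Finset.mem_univ, if_true, hn,
        if_false, sub_zero]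
      exact (G.reachProb_of_parentMove g h).symm
  have h2 : ∀ m, ∑ a, ∑ n, F n (m, a) = if G.decision m then G.reachProb g m else 0 := by
    intro m
    split_ifs with hm
    · have h3 : ∀ a, ∑ n, F n (m, a) = G.reachProb g m * g (G.info m) a := by
        intro a
        by_cases ha : a ∈ G.avail (G.info m)
        · obtain ⟨n, hn, huniq⟩ := G.child_exists m hm a ha
          rw [Finset.sum_eq_single n]
          · simp [F, hn]
          · intro b _ hb
            exact if_neg fun h => hb (huniq b h)
          · simp
        · rw [hg.2.2 _ _ ha, mul_zero]
          refine Finset.sum_eq_zero fun n _ => if_neg fun h => ha (G.parent_decision n m a h).2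
      simp only [h3]
      rw [← Finset.mul_sum, ← Finset.sum_subset (Finset.subset_univ (G.avail (G.info m)))
        fun a _ ha => hg.2.2 _ a ha, hg.2.1, mul_one]
    · refine Finset.sum_eq_zero fun a _ => Finset.sum_eq_zero fun n _ => if_neg fun h =>
        hm (G.parent_decision n m a h).1
  have h4 : ∑ n, ∑ p, F n p = ∑ m, ∑ a, ∑ n, F n (m, a) := by
    rw [Finset.sum_comm, Fintype.sum_prod_type]
  simp only [h1, h2, Finset.sum_sub_distrib, Finset.sum_ite_eq', Finset.mem_univ, if_true] at h4
  have h5 := Finset.sum_filter_add_sum_filter_not Finset.univ (fun n => ¬ G.decision n)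
    (G.reachProb g)
  have h6 : ∑ m, (if G.decision m then G.reachProb g m else 0)
      = ∑ m ∈ Finset.univ.filter (fun n => ¬ ¬ G.decision n), G.reachProb g m := by
    simp [Finset.sum_filter]
  rw [h6] at h4
  unfold terminalSet
  linarith

lemma isProfile_replace (G : ExtGame) {g : G.Info → G.Move → ℝ} (hg : G.IsProfile g)
    {h : G.Info} {a : G.Move} (ha : a ∈ G.avail h) : G.IsProfile (G.replace g h a) := by
  refine ⟨fun h' b => ?_, fun h' => ?_, fun h' b hb => ?_⟩
  · unfold replace
    split_ifs
    · exact zero_le_one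
    · exact le_rfl
    · exact hg.1 _ _
  · by_cases hh : h' = h
    · subst hh
      simp [replace, ha]
    · simpa [replace, hh] using hg.2.1 h'
  · by_cases hh : h' = h
    · subst hh
      have : b ≠ a := fun e => hb (e ▸ ha)
      simp [replace, this]
    · simpa [replace, hh] using hg.2.2 h' b hb

lemma isProfile_le_one (G : ExtGame) {g : G.Info → G.Move → ℝ} (hg : G.IsProfile g)
    {h : G.Info} {a : G.Move} (ha : a ∈ G.avail h) : g h a ≤ 1 := by
  rw [← hg.2.1 h]
  exact Finset.single_le_sum (f := g h) (fun b _ => hg.1 h b) ha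

lemma abs_le_umax (G : ExtGame) (u : G.Node → ℝ) {n : G.Node} (hn : n ∈ G.terminalSet) :
    |u n| ≤ G.umax u := by
  have : {x : ℝ | ∃ zz ∈ G.terminalSet, x = |u zz|} = (fun zz => |u zz|) '' G.terminalSet := by
    ext x
    simp [eq_comm]
  unfold umax
  rw [this]
  exact le_csSup (G.terminalSet.finite_toSet.image _).bddAbove (Set.mem_image_of_mem _ hn)

lemma dmin_le (G : ExtGame) (u : G.Node → ℝ) {n m : G.Node} (hn : n ∈ G.terminalSet)
    (hm : m ∈ G.terminalSet) (hne : n ≠ m) : G.dmin u ≤ |u n - u m| := by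
  refine csInf_le ⟨0, ?_⟩ ⟨n, hn, m, hm, hne, rfl⟩
  rintro x ⟨_, _, _, _, _, rfl⟩
  exact abs_nonneg _

lemma dmin_pos (G : ExtGame) (u : G.Node → ℝ)
    (hu : ∀ n m : G.Node, ¬ G.decision n → ¬ G.decision m → u n = u m → n = m)
    {n m : G.Node} (hn : n ∈ G.terminalSet) (hm : m ∈ G.terminalSet) (hne : n ≠ m) :
    0 < G.dmin u := by
  have hmem : G.dmin u ∈
      {x : ℝ | ∃ zz ∈ G.terminalSet, ∃ zz' ∈ G.terminalSet, zz ≠ zz' ∧ x = |u zz - u zz'|} := by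
    refine Set.Nonempty.csInf_mem ⟨_, n, hn, m, hm, hne, rfl⟩ ?_
    refine Set.Finite.subset (Set.finite_range fun q : G.Node × G.Node => |u q.1 - u q.2|) ?_
    rintro x ⟨a, _, b, _, _, rfl⟩
    exact ⟨(a, b), rfl⟩
  obtain ⟨a, ha, b, hb, hab, h⟩ := hmem
  rw [h, abs_pos, sub_ne_zero]
  exact fun h => hab (hu a b (G.mem_terminalSet.1 ha) (G.mem_terminalSet.1 hb) h)

/-- A profile that reaches the terminal node `n` with probability at least
`1 - Δ_min / (8 u_max)` has payoff within `Δ_min / 4` of `u n`. -/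
lemma abs_eu_sub_le (G : ExtGame) (u : G.Node → ℝ) {g : G.Info → G.Move → ℝ}
    (hg : G.IsProfile g) {n : G.Node} (hn : n ∈ G.terminalSet) (hmax : 0 < G.umax u)
    (hreach : 1 - G.dmin u / (8 * G.umax u) ≤ G.reachProb g n) :
    |G.eu u g - u n| ≤ G.dmin u / 4 := by
  have hsum := G.sum_reachProb_terminalSet hg
  have hsplit := Finset.add_sum_erase G.terminalSet (G.reachProb g) hn
  have hval := Finset.add_sum_erase G.terminalSet (fun z => u z * G.reachProb g z) hn
  have hrest : |∑ z ∈ G.terminalSet.erase n, u z * G.reachProb g z|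
      ≤ G.umax u * ∑ z ∈ G.terminalSet.erase n, G.reachProb g z := by
    rw [Finset.mul_sum]
    refine (Finset.abs_sum_le_sum_abs _ _).trans (Finset.sum_le_sum fun z hz => ?_)
    rw [abs_mul, abs_of_nonneg (G.reachProb_nonneg hg z)]
    exact mul_le_mul_of_nonneg_right (G.abs_le_umax u (Finset.mem_of_mem_erase hz))
      (G.reachProb_nonneg hg z)
  set S := ∑ z ∈ G.terminalSet.erase n, G.reachProb g z
  have hS : S = 1 - G.reachProb g n := by linarith
  have hS0 : 0 ≤ S := Finset.sum_nonneg fun z _ => G.reachProb_nonneg hg z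
  have hle : G.umax u * S ≤ G.dmin u / 8 := by
    have h1 : S ≤ G.dmin u / (8 * G.umax u) := by linarith
    calc G.umax u * S ≤ G.umax u * (G.dmin u / (8 * G.umax u)) :=
          mul_le_mul_of_nonneg_left h1 hmax.le
      _ = G.dmin u / 8 := by field_simp
  have heq : G.eu u g - u n = (∑ z ∈ G.terminalSet.erase n, u z * G.reachProb g z) - u n * S := by
    unfold eu
    rw [hS, ← hval]
    ring
  have hun : |u n * S| ≤ G.umax u * S := by
    rw [abs_mul, abs_of_nonneg hS0]
    exact mul_le_mul_of_nonneg_right (G.abs_le_umax u hn) hS0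
  rw [heq]
  refine (abs_sub _ _).trans ?_
  linarith

lemma dmin_le_two_mul_umax (G : ExtGame) (u : G.Node → ℝ) {n m : G.Node}
    (hn : n ∈ G.terminalSet) (hm : m ∈ G.terminalSet) (hne : n ≠ m) :
    G.dmin u ≤ 2 * G.umax u := by
  have h1 := G.dmin_le u hn hm hne
  have h2 := abs_sub (u n) (u m)
  linarith [G.abs_le_umax u hn, G.abs_le_umax u hm]

lemma length_le_lmax (G : ExtGame) {n : G.Node} (hn : n ∈ G.terminalSet) :
    (G.pathPairs n).length ≤ G.lmax :=
  Finset.le_sup (f := fun zz => (G.pathPairs zz).length) hn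

lemma le_list_prod_map {β : Type*} (l : List β) (φ : β → ℝ) {c : ℝ} (hc : 0 ≤ c)
    (h : ∀ p ∈ l, c ≤ φ p) : c ^ l.length ≤ (l.map φ).prod := by
  induction l with
  | nil => simp
  | cons p l ih =>
    rw [List.map_cons, List.prod_cons, List.length_cons, pow_succ']
    exact mul_le_mul (h p (by simp)) (ih fun q hq => h q (by simp [hq])) (pow_nonneg hc _)
      (hc.trans (h p (by simp)))

/-- If all moves towards `n` have probability at least the threshold, then `n` is reached with
probability at least `1 - Δ_min / (8 u_max)`. -/
lemma le_reachProb_of_thr_le (G : ExtGame) (u : G.Node → ℝ) (g : G.Info → G.Move → ℝ)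
    {n : G.Node} (hn : n ∈ G.terminalSet) (hl : G.lmax ≠ 0)
    (hbase : 0 ≤ 1 - G.dmin u / (8 * G.umax u)) (hthr : G.thr u ≤ 1)
    (h : ∀ p ∈ G.pathPairs n, G.thr u ≤ g p.1 p.2) :
    1 - G.dmin u / (8 * G.umax u) ≤ G.reachProb g n := by
  have h0 : 0 ≤ G.thr u := Real.rpow_nonneg hbase _
  calc 1 - G.dmin u / (8 * G.umax u) = G.thr u ^ G.lmax := (Real.rpow_inv_natCast_pow hbase hl).symm
    _ ≤ G.thr u ^ (G.pathPairs n).length := pow_le_pow_of_le_one h0 hthr (G.length_le_lmax hn)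
    _ ≤ G.reachProb g n := le_list_prod_map _ _ h0 h

/-- A sequence in `S` each of whose steps increases `u` or reaches a point not seen before has at
most `(|S| - 1) |S|` steps. -/
lemma length_le_of_increasing_or_new {β : Type*} (S : Finset β) (u : β → ℝ)
    (hu : Set.InjOn u S) (w : ℕ → β) (N : ℕ) (hw : ∀ i ≤ N, w i ∈ S)
    (hstep : ∀ i < N, u (w i) < u (w (i + 1)) ∨ ∀ j ≤ i, w j ≠ w (i + 1)) :
    N ≤ (S.card - 1) * S.card := by
  let start : ℕ → β := fun i => Nat.rec (motive := fun _ => β) (w 0)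
    (fun k b => if u (w k) < u (w (k + 1)) then b else w (k + 1)) i
  have hs : ∀ k, start (k + 1) = if u (w k) < u (w (k + 1)) then start k else w (k + 1) :=
    fun _ => rfl
  have hmem : ∀ i, ∃ j ≤ i, start i = w j := by
    intro i
    induction i with
    | zero => exact ⟨0, le_rfl, rfl⟩
    | succ k ih =>
      rw [hs]
      split_ifs
      · obtain ⟨j, hj, h⟩ := ih
        exact ⟨j, hj.trans k.le_succ, h⟩
      · exact ⟨k + 1, le_rfl, rfl⟩
  have hle : ∀ i, u (start i) ≤ u (w i) := by
    intro i
    induction i with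
    | zero => exact le_rfl
    | succ k ih =>
      rw [hs]
      split_ifs with h
      · exact ih.trans h.le
      · exact le_rfl
  have hsep : ∀ i d, i + d < N → (start (i + d + 1) = start i ∧ u (w i) < u (w (i + d + 1))) ∨
      ∀ k ≤ i, w k ≠ start (i + d + 1) := by
    intro i d
    induction d with
    | zero =>
      intro hi
      rw [Nat.add_zero, hs]
      split_ifs with h
      · exact Or.inl ⟨rfl, h⟩
      · exact Or.inr ((hstep i hi).resolve_left h)
    | succ d ih =>
      intro hi
      have hi' := ih (by omega)
      rw [hs, show i + (d + 1) = i + d + 1 by ring]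
      split_ifs with h
      · exact hi'.imp (fun q => ⟨q.1, q.2.trans h⟩) id
      · refine Or.inr fun k hk => ?_
        exact (hstep (i + d + 1) (by omega)).resolve_left h k (by omega)
  obtain ⟨top, htop, hmax⟩ := S.exists_max_image u ⟨w 0, hw 0 (Nat.zero_le _)⟩
  let φ : ℕ → β × β := fun i => (start i, w i)
  have hne : ∀ i j, i < j → j ≤ N → φ i ≠ φ j := by
    intro i j hij hj h
    obtain ⟨d, rfl⟩ := Nat.exists_eq_add_of_lt hij
    have h1 : start i = start (i + d + 1) := congrArg Prod.fst h
    have h2 : w i = w (i + d + 1) := congrArg Prod.snd h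
    rcases hsep i d (by omega) with h3 | h3
    · exact absurd h3.2 (by rw [h2]; exact lt_irrefl _)
    · obtain ⟨k, hk, hk'⟩ := hmem i
      exact h3 k hk (by rw [← hk', h1])
  have hinj : Set.InjOn φ (Finset.range (N + 1)) := by
    intro i hi j hj h
    simp only [Finset.coe_range, Set.mem_Iio] at hi hj
    rcases lt_trichotomy i j with hij | hij | hij
    · exact absurd h (hne i j hij (by omega))
    · exact hij
    · exact absurd h.symm (hne j i hij (by omega))
  have hmaps : Set.MapsTo φ (Finset.range (N + 1))
      (insert (top, top) ((S.erase top) ×ˢ S) : Finset (β × β)) := by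
    intro i hi
    simp only [Finset.coe_range, Set.mem_Iio] at hi
    have hwi := hw i (by omega)
    obtain ⟨j, hj, hj'⟩ := hmem i
    have hsi : start i ∈ S := hj' ▸ hw j (by omega)
    simp only [φ, Finset.coe_insert, Set.mem_insert_iff, Finset.mem_coe, Finset.mem_product,
      Finset.mem_erase, Prod.mk.injEq]
    rcases eq_or_ne (start i) top with ht | ht
    · refine Or.inl ⟨ht, hu hwi htop (le_antisymm (hmax _ hwi) ?_)⟩
      exact ht ▸ hle i
    · exact Or.inr ⟨⟨ht, hsi⟩, hwi⟩
  have hcard := Finset.card_le_card_of_injOn φ hmaps hinj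
  have hins := Finset.card_insert_le (top, top) ((S.erase top) ×ˢ S)
  rw [Finset.card_product, Finset.card_erase_of_mem htop] at hins
  rw [Finset.card_range] at hcard
  omega

namespace IsFPInertiaPath

variable {G : ExtGame} {u : G.Node → ℝ} {ρ : ℝ} {α : G.Info → ℝ}
  {f : ℕ → G.Info → G.Move → ℝ} {A : ℕ → G.Info → G.Move} {z : ℕ → G.Node}

lemma Kt_spec (hFP : G.IsFPInertiaPath u ρ α f A z) (hthr : G.thr u < 1) {t : ℕ} (ht : 1 ≤ t) :
    ∀ p ∈ G.pathPairs (z t), G.thr u ≤ (1 - ρ) ^ (G.Kt u ρ f z t + 1) * f t p.1 p.2 + 1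
      - (1 - ρ) ^ (G.Kt u ρ f z t + 1) := by
  have hne : {K : ℕ | ∀ p ∈ G.pathPairs (z t),
      G.thr u ≤ (1 - ρ) ^ (K + 1) * f t p.1 p.2 + 1 - (1 - ρ) ^ (K + 1)}.Nonempty := by
    have h0 : (0 : ℝ) ≤ 1 - ρ := by linarith [hFP.rho_mem.2]
    have h1 : 1 - ρ < 1 := by linarith [hFP.rho_mem.1]
    obtain ⟨K, hK⟩ := exists_pow_lt_of_lt_one (sub_pos.2 hthr) h1
    refine ⟨K, fun p _ => ?_⟩
    have h2 : (1 - ρ) ^ (K + 1) ≤ (1 - ρ) ^ K := pow_le_pow_of_le_one h0 h1.le K.le_succ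
    have h3 : 0 ≤ (1 - ρ) ^ (K + 1) * f t p.1 p.2 :=
      mul_nonneg (pow_nonneg h0 _) ((hFP.profile t ht).1 _ _)
    linarith
  exact Nat.sInf_mem hne

lemma freq_of_repeat (hFP : G.IsFPInertiaPath u ρ α f A z) {t : ℕ} (ht : 1 ≤ t) {h : G.Info}
    {a : G.Move} (ha : (h, a) ∈ G.pathPairs (z t)) (M : ℕ) (hrep : ∀ k < M, z (t + k) = z t) :
    f (t + M) h a = (1 - ρ) ^ M * f t h a + 1 - (1 - ρ) ^ M := by
  induction M with
  | zero => simp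
  | succ M ih =>
    have hv : G.visits h (z t) := ⟨a, ha⟩
    have hc : G.chooses h a (z t) := ha
    rw [← Nat.add_assoc, hFP.update (t + M) (by omega), hrep M M.lt_succ_self]
    simp only [fadeStep, visitInd, chooseInd, hv, hc, if_true,
      ih fun k hk => hrep k (hk.trans M.lt_succ_self)]
    ring

lemma unvisited_of_repeat (hFP : G.IsFPInertiaPath u ρ α f A z) {t : ℕ} (ht : 1 ≤ t) {h : G.Info}
    (hv : ¬ G.visits h (z (t + 1))) (M : ℕ) (hrep : ∀ k < M, z (t + 1 + k) = z (t + 1)) :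
    f (t + 1 + M) h = f (t + 1) h ∧ A (t + M) h = A t h := by
  induction M with
  | zero => simp
  | succ M ih =>
    obtain ⟨h1, h2⟩ := ih fun k hk => hrep k (hk.trans M.lt_succ_self)
    have hz := hrep M M.lt_succ_self
    constructor
    · rw [← Nat.add_assoc, hFP.update (t + 1 + M) (by omega), hz, ← h1]
      funext a
      simp [fadeStep, visitInd, hv]
    · have h3 := hFP.inertia_unreached (t + 1 + M) (by omega) h (by rwa [hz])
      rw [show t + 1 + M - 1 = t + M by omega, h2] at h3
      rw [← h3]
      congr 1
      omega

lemma one_le_tseq {t0 : ℕ} (ht0 : 1 ≤ t0) (ℓ : ℕ) : 1 ≤ G.tseq u ρ f z t0 ℓ := by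
  cases ℓ with
  | zero => exact ht0
  | succ k => exact Nat.succ_le_succ (Nat.zero_le _)

lemma repeat_of_deviateEvent {t : ℕ} (hfin : G.mt u ρ f z t ≠ ⊤)
    (hE : G.deviateEvent u ρ f z A t) :
    ∀ k < G.Kt u ρ f z t + (G.mt u ρ f z t).toNat + 1, z (t + k) = z t := by
  have h := hE.1
  rw [repeatLockEvent, if_neg hfin] at h
  exact fun k hk => h k (Nat.lt_succ_iff.1 hk)

lemma apply_st_of_deviateEvent {t : ℕ} (hfin : G.mt u ρ f z t ≠ ⊤)
    (hE : G.deviateEvent u ρ f z A t) : z (G.st u ρ f z t) = z t := by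
  rw [st, Nat.add_assoc]
  exact repeat_of_deviateEvent hfin hE _ (Nat.lt_succ_self _)

lemma thr_le_freq_of_visits (hFP : G.IsFPInertiaPath u ρ α f A z) (hthr : G.thr u < 1) {t : ℕ}
    (ht : 1 ≤ t) (hfin : G.mt u ρ f z t ≠ ⊤) (hE : G.deviateEvent u ρ f z A t) {h : G.Info}
    (hv : G.visits h (z t)) :
    G.thr u ≤ f (G.st u ρ f z t + 1) h (A (G.st u ρ f z t) h) := by
  obtain ⟨a, ha⟩ := hv
  have hst : 1 ≤ G.st u ρ f z t := by
    unfold st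
    omega
  have hA : A (G.st u ρ f z t) h = a :=
    hFP.outcome _ hst (h, a) (by rw [apply_st_of_deviateEvent hfin hE]; exact ha)
  have havail : a ∈ G.avail h := hA ▸ hFP.pure_valid _ hst h
  have hf := G.isProfile_le_one (hFP.profile t ht) havail
  have hfreq := hFP.freq_of_repeat ht ha _ (repeat_of_deviateEvent hfin hE)
  have hK := hFP.Kt_spec hthr ht (h, a) ha
  have hpow : (1 - ρ) ^ (G.Kt u ρ f z t + (G.mt u ρ f z t).toNat + 1)
      ≤ (1 - ρ) ^ (G.Kt u ρ f z t + 1) :=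
    pow_le_pow_of_le_one (by linarith [hFP.rho_mem.2]) (by linarith [hFP.rho_mem.1]) (by omega)
  rw [hA, show G.st u ρ f z t + 1 = t + (G.Kt u ρ f z t + (G.mt u ρ f z t).toNat + 1) by
    unfold st; omega, hfreq]
  dsimp only at hK
  nlinarith [mul_le_mul_of_nonneg_right hpow (sub_nonneg.2 hf)]

/-- At the end of each block of repetitions, the most recent move at every information set
visited since the start of the chain has frequency at least the threshold. -/
lemma thr_le_freq (hFP : G.IsFPInertiaPath u ρ α f A z) (hthr : G.thr u < 1) {t0 : ℕ}
    (ht0 : 1 ≤ t0) {n : ℕ}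
    (hfin : ∀ ℓ ≤ n, G.mt u ρ f z (G.tseq u ρ f z t0 ℓ) ≠ ⊤)
    (hE : ∀ ℓ ≤ n, G.deviateEvent u ρ f z A (G.tseq u ρ f z t0 ℓ)) :
    ∀ ℓ ≤ n, ∀ j ≤ ℓ, ∀ h, G.visits h (z (G.tseq u ρ f z t0 j)) →
      G.thr u ≤ f (G.tseq u ρ f z t0 (ℓ + 1)) h (A (G.st u ρ f z (G.tseq u ρ f z t0 ℓ)) h) := by
  intro ℓ
  induction ℓ with
  | zero =>
    intro hℓ j hj h hv
    obtain rfl : j = 0 := Nat.le_zero.1 hj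
    exact hFP.thr_le_freq_of_visits hthr ht0 (hfin 0 hℓ) (hE 0 hℓ) hv
  | succ k ih =>
    intro hℓ j hj h hv
    by_cases hcur : G.visits h (z (G.tseq u ρ f z t0 (k + 1)))
    · exact hFP.thr_le_freq_of_visits hthr (one_le_tseq ht0 _) (hfin _ hℓ) (hE _ hℓ) hcur
    · have hjk : j ≤ k := by
        rcases Nat.lt_or_ge k j with hlt | hge
        · obtain rfl : j = k + 1 := le_antisymm hj hlt
          exact absurd hv hcur
        · exact hge
      have hprev := ih (by omega) j hjk h hv
      have hs : 1 ≤ G.st u ρ f z (G.tseq u ρ f z t0 k) :=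
        (one_le_tseq (u := u) (ρ := ρ) (f := f) (z := z) ht0 k).trans (by unfold st; omega)
      have hrep := repeat_of_deviateEvent (hfin _ hℓ) (hE _ hℓ)
      have h3 : G.tseq u ρ f z t0 (k + 1) = G.st u ρ f z (G.tseq u ρ f z t0 k) + 1 := rfl
      have h4 : G.tseq u ρ f z t0 (k + 1 + 1) = G.st u ρ f z (G.tseq u ρ f z t0 (k + 1)) + 1 := rfl
      have h5 : G.st u ρ f z (G.tseq u ρ f z t0 (k + 1)) = G.tseq u ρ f z t0 (k + 1)
          + G.Kt u ρ f z (G.tseq u ρ f z t0 (k + 1))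
          + (G.mt u ρ f z (G.tseq u ρ f z t0 (k + 1))).toNat := rfl
      generalize G.Kt u ρ f z (G.tseq u ρ f z t0 (k + 1)) = K at hrep h5
      generalize (G.mt u ρ f z (G.tseq u ρ f z t0 (k + 1))).toNat = m at hrep h5
      generalize G.st u ρ f z (G.tseq u ρ f z t0 (k + 1)) = s' at h4 h5 ⊢
      generalize G.st u ρ f z (G.tseq u ρ f z t0 k) = s at hs h3 hprev
      rw [h3] at hprev hcur hrep h5
      obtain ⟨h1, h2⟩ := hFP.unvisited_of_repeat hs hcur _ hrep
      rw [h4, show s' = s + (K + m + 1) by omega, h2,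
        show s + (K + m + 1) + 1 = s + 1 + (K + m + 1) by omega, h1]
      exact hprev

/-- The deviation ending a block leads to a different terminal node. -/
lemma ne_of_deviateEvent {t : ℕ} (hfin : G.mt u ρ f z t ≠ ⊤)
    (hE : G.deviateEvent u ρ f z A t) : z t ≠ z (G.st u ρ f z t + 1) := by
  intro heq
  obtain ⟨-, h, a, a', hmem, -, hlt, hpath⟩ := hE.2
  rw [apply_st_of_deviateEvent hfin hE, heq] at hmem
  have := hpath _ hmem
  simp only [if_true] at this
  exact absurd hlt (by rw [this]; exact lt_irrefl _)

/-- A deviation leading to a terminal node already played in the chain increases the payoff. -/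
lemma lt_of_deviateEvent_of_visited (hFP : G.IsFPInertiaPath u ρ α f A z)
    (hmax : 0 < G.umax u) (hbase : 0 ≤ 1 - G.dmin u / (8 * G.umax u)) (hl : G.lmax ≠ 0)
    (hd : 0 < G.dmin u) (hthr : G.thr u < 1) {t0 : ℕ}
    (ht0 : 1 ≤ t0) {n : ℕ}
    (hfin : ∀ ℓ ≤ n, G.mt u ρ f z (G.tseq u ρ f z t0 ℓ) ≠ ⊤)
    (hE : ∀ ℓ ≤ n, G.deviateEvent u ρ f z A (G.tseq u ρ f z t0 ℓ)) {ℓ j : ℕ} (hℓ : ℓ ≤ n)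
    (hj : j ≤ ℓ) (hjz : z (G.tseq u ρ f z t0 j) = z (G.tseq u ρ f z t0 (ℓ + 1))) :
    u (z (G.tseq u ρ f z t0 ℓ)) < u (z (G.tseq u ρ f z t0 (ℓ + 1))) := by
  have hfreq := hFP.thr_le_freq hthr ht0 hfin hE ℓ hℓ
  have hterm : ∀ i, z (G.tseq u ρ f z t0 i) ∈ G.terminalSet := fun i =>
    G.mem_terminalSet.2 (hFP.terminal _ (one_le_tseq ht0 i))
  have hne : z (G.tseq u ρ f z t0 ℓ) ≠ z (G.tseq u ρ f z t0 (ℓ + 1)) :=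
    ne_of_deviateEvent (hfin ℓ hℓ) (hE ℓ hℓ)
  have hgap := G.dmin_le u (hterm _) (hterm _) hne
  have hlast := apply_st_of_deviateEvent (hfin ℓ hℓ) (hE ℓ hℓ)
  obtain ⟨-, h, a, a', hmem, ha', hlt, hpath⟩ := (hE ℓ hℓ).2
  have hT : G.st u ρ f z (G.tseq u ρ f z t0 ℓ) + 1 = G.tseq u ρ f z t0 (ℓ + 1) := rfl
  have hs : 1 ≤ G.st u ρ f z (G.tseq u ρ f z t0 ℓ) :=
    (one_le_tseq (u := u) (ρ := ρ) (f := f) (z := z) ht0 ℓ).trans (by unfold st; omega)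
  have hout := hFP.outcome _ hs
  have hpure := hFP.pure_valid _ hs
  rw [hT] at hlt hpath
  rw [hlast] at hmem hout
  set s := G.st u ρ f z (G.tseq u ρ f z t0 ℓ)
  set T := G.tseq u ρ f z t0 (ℓ + 1)
  have hprof : G.IsProfile (f T) := hFP.profile _ (one_le_tseq ht0 _)
  have hAa : A s h = a := hout _ hmem
  have ha : a ∈ G.avail h := hAa ▸ hpure h
  have hold := G.abs_eu_sub_le u (G.isProfile_replace hprof ha) (hterm ℓ) hmax
    (G.le_reachProb_of_thr_le u _ (hterm ℓ) hl hbase hthr.le (by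
      intro p hp
      have hA : A s p.1 = p.2 := hout p hp
      by_cases hph : p.1 = h
      · have : p.2 = a := by rw [← hA, hph, hAa]
        simp [replace, hph, this, hthr.le]
      · simp only [replace, hph, if_false]
        rw [← hA]
        exact hfreq ℓ le_rfl _ ⟨p.2, hp⟩))
  have hnew := G.abs_eu_sub_le u (G.isProfile_replace hprof ha') (hterm (ℓ + 1)) hmax
    (G.le_reachProb_of_thr_le u _ (hterm (ℓ + 1)) hl hbase hthr.le (by
      intro p hp
      have hp2 := hpath p hp
      by_cases hph : p.1 = h
      · rw [if_pos hph] at hp2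
        simp [replace, hph, hp2, hthr.le]
      · rw [if_neg hph] at hp2
        simp only [replace, hph, if_false]
        rw [hp2]
        exact hfreq j hj _ ⟨p.2, hjz ▸ hp⟩))
  by_contra hcon
  rw [abs_of_nonneg (sub_nonneg.2 (not_lt.1 hcon))] at hgap
  have h1 := (abs_le.1 hold).1
  have h2 := (abs_le.1 hnew).2
  linarith

end IsFPInertiaPath

end ExtGame

/-- **Lemma 3.** Under FP with inertia and fading memory in a
common-payoff game with pairwise-distinct terminal payoffs, the events
`Ê_{t_0} ∩ … ∩ Ê_{t_n}` (with `t_{ℓ+1} = t_ℓ + K_{t_ℓ} + m_{t_ℓ} + 1` and all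
`m_{t_ℓ} < ∞`) can occur only if `n < (|Z| − 1)|Z|`. -/
theorem fp_inertia_deviation_chain_bounded (G : ExtGame)
    (u : G.Node → ℝ) (hPR : G.PerfectRecall)
    (hdistinct : ∀ zz zz' : G.Node, ¬ G.decision zz → ¬ G.decision zz' →
      u zz = u zz' → zz = zz')
    (ρ : ℝ) (α : G.Info → ℝ)
    (f : ℕ → G.Info → G.Move → ℝ) (A : ℕ → G.Info → G.Move) (z : ℕ → G.Node)
    (hFP : G.IsFPInertiaPath u ρ α f A z)
    (t0 : ℕ) (ht0 : 1 ≤ t0) (n : ℕ)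
    (hfin : ∀ ℓ ≤ n, G.mt u ρ f z (G.tseq u ρ f z t0 ℓ) ≠ ⊤)
    (hE : ∀ ℓ ≤ n, G.deviateEvent u ρ f z A (G.tseq u ρ f z t0 ℓ)) :
    n < (G.terminalSet.card - 1) * G.terminalSet.card := by
  have hterm : ∀ i, z (G.tseq u ρ f z t0 i) ∈ G.terminalSet := fun i =>
    G.mem_terminalSet.2 (hFP.terminal _ (IsFPInertiaPath.one_le_tseq ht0 i))
  have hne : z (G.tseq u ρ f z t0 0) ≠ z (G.tseq u ρ f z t0 1) :=
    IsFPInertiaPath.ne_of_deviateEvent (hfin 0 n.zero_le) (hE 0 n.zero_le)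
  have hd := G.dmin_pos u hdistinct (hterm 0) (hterm 1) hne
  have hdu := G.dmin_le_two_mul_umax u (hterm 0) (hterm 1) hne
  have hmax : 0 < G.umax u := by linarith
  have hratio : 0 < G.dmin u / (8 * G.umax u) := by positivity
  have hratio' : G.dmin u / (8 * G.umax u) ≤ 1 := by
    rw [div_le_one (by positivity)]
    linarith
  have hbase : 0 ≤ 1 - G.dmin u / (8 * G.umax u) := by linarith
  have hl : 0 < G.lmax := by
    obtain ⟨-, h, a, a', hmem, -⟩ := (hE 0 n.zero_le).2
    rw [IsFPInertiaPath.apply_st_of_deviateEvent (hfin 0 n.zero_le) (hE 0 n.zero_le)] at hmem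
    exact (List.length_pos_of_mem hmem).trans_le (G.length_le_lmax (hterm 0))
  have hthr : G.thr u < 1 :=
    Real.rpow_lt_one hbase (by linarith) (inv_pos.2 (Nat.cast_pos.2 hl))
  refine Nat.lt_of_succ_le (length_le_of_increasing_or_new G.terminalSet u ?_
    (fun i => z (G.tseq u ρ f z t0 i)) (n + 1) (fun i _ => hterm i) ?_)
  · intro x hx y hy hxy
    exact hdistinct x y (G.mem_terminalSet.1 hx) (G.mem_terminalSet.1 hy) hxy
  · intro ℓ hℓ
    by_contra! hcon
    obtain ⟨hle, j, hj, hjz⟩ := hcon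
    exact absurd (hFP.lt_of_deviateEvent_of_visited hmax hbase hl.ne' hd hthr ht0 hfin hE
      (Nat.lt_succ_iff.1 hℓ) hj hjz) (not_lt.2 hle)
end
end

section
/- Let Z be a nonempty finite set, u : Z → ℝ, and set u_max := max_{z∈Z} |u(z)| and Δ_min := min_{z≠z̄} |u(z) − u(z̄)|; assume u_max > 0 and Δ_min > 0 (i.e., u is injective). Let P and Q be probability distributions on Z, and let z, z' ∈ Z with z ≠ z' be such that P({z'}) ≥ 1 − Δ_min/(8 u_max) and Q({z}) ≥ 1 − Δ_min/(8 u_max). If Σ_{w∈Z} u(w) P({w}) > Σ_{w∈Z} u(w) Q({w}), then u(z') > u(z). -/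
open scoped BigOperators

/-- The expectation of a function bounded by `M` differs from its value at `z` by at most
`2 * M` times the mass off `z`. -/
theorem abs_expectation_sub_le {Z : Type*} [Fintype Z] (u P : Z → ℝ) {M : ℝ}
    (hM : ∀ w, |u w| ≤ M) (hP : ∀ w, 0 ≤ P w) (hsum : ∑ w, P w = 1) (z : Z) :
    |∑ w, u w * P w - u z| ≤ 2 * M * (1 - P z) := by
  classical
  have hcenter : ∑ w, u w * P w - u z = ∑ w, (u w - u z) * P w := by
    simp only [sub_mul, Finset.sum_sub_distrib, ← Finset.mul_sum, hsum, mul_one]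
  have hmass : ∑ w, 2 * M * (P w - if w = z then P w else 0) = 2 * M * (1 - P z) := by
    rw [← Finset.mul_sum, Finset.sum_sub_distrib, hsum]
    simp
  rw [hcenter, ← hmass]
  refine (Finset.abs_sum_le_sum_abs _ _).trans (Finset.sum_le_sum fun w _ => ?_)
  by_cases h : w = z
  · simp [h]
  · rw [abs_mul, abs_of_nonneg (hP w), if_neg h, sub_zero]
    refine mul_le_mul_of_nonneg_right ?_ (hP w)
    linarith [abs_sub (u w) (u z), hM w, hM z]

/-- Abstract comparison inequality underlying Lemma 2: if two
probability distributions `P, Q` on a finite set `Z` put mass at least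
`1 − Δ_min/(8 u_max)` on `z'` and `z` respectively (`z ≠ z'`), where
`u_max = max_w |u w| > 0` and `Δ_min = min_{w ≠ w'} |u w − u w'| > 0`, and the
expectation of `u` under `P` strictly exceeds that under `Q`, then `u z' > u z`. -/
theorem nearly_deterministic_expectation_comparison
    {Z : Type*} [Fintype Z] [Nonempty Z] (u : Z → ℝ)
    (umax Δmin : ℝ)
    (humax : umax = sSup (Set.range fun w => |u w|))
    (hΔmin : Δmin = sInf {d : ℝ | ∃ w w' : Z, w ≠ w' ∧ d = |u w - u w'|})
    (humax_pos : 0 < umax) (hΔmin_pos : 0 < Δmin)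
    (P Q : Z → ℝ)
    (hPnonneg : ∀ w, 0 ≤ P w) (hPsum : ∑ w, P w = 1)
    (hQnonneg : ∀ w, 0 ≤ Q w) (hQsum : ∑ w, Q w = 1)
    (z z' : Z) (hne : z ≠ z')
    (hPz' : 1 - Δmin / (8 * umax) ≤ P z')
    (hQz : 1 - Δmin / (8 * umax) ≤ Q z)
    (hexp : ∑ w, u w * Q w < ∑ w, u w * P w) :
    u z < u z' := by
  have hM : ∀ w, |u w| ≤ umax := fun w =>
    humax ▸ le_csSup (Set.finite_range _).bddAbove ⟨w, rfl⟩
  have hgap : Δmin ≤ |u z - u z'| := by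
    rw [hΔmin]
    refine csInf_le ⟨0, ?_⟩ ⟨z, z', hne, rfl⟩
    rintro d ⟨w, w', -, rfl⟩
    exact abs_nonneg _
  have hdev : ∀ p : ℝ, 1 - Δmin / (8 * umax) ≤ p → 2 * umax * (1 - p) ≤ Δmin / 4 := by
    intro p hp
    calc 2 * umax * (1 - p) ≤ 2 * umax * (Δmin / (8 * umax)) :=
          mul_le_mul_of_nonneg_left (by linarith) (by positivity)
      _ = Δmin / 4 := by field_simp; norm_num
  have hEP := abs_le.1 ((abs_expectation_sub_le u P hM hPnonneg hPsum z').trans (hdev _ hPz'))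
  have hEQ := abs_le.1 ((abs_expectation_sub_le u Q hM hQnonneg hQsum z).trans (hdev _ hQz))
  by_contra! hle
  rw [abs_of_nonneg (sub_nonneg.2 hle)] at hgap
  linarith [hEP.2, hEQ.1]
end

section
/- Let Z be a nonempty finite set with |Z| elements, u : Z → ℝ, and let z_0, z_1, …, z_{n+1} be a finite sequence in Z with z_1 ≠ z_0, such that for every ℓ ∈ {0, …, n}: if z_{ℓ+1} ∈ {z_0, …, z_ℓ}, then u(z_{ℓ+1}) > u(z_ℓ). Then n < (|Z| − 1)·|Z|. -/
/-- A map strictly increasing along `f k, f (k + 1), …, f (k + |Z|)` would take more than `|Z|`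
values, so some step of any such stretch does not increase it. -/
lemma exists_step_not_lt {Z : Type*} [Fintype Z] {α : Type*} [Preorder α] (u : Z → α)
    (f : ℕ → Z) (k : ℕ) :
    ∃ l, k ≤ l ∧ l < k + Fintype.card Z ∧ ¬ u (f l) < u (f (l + 1)) := by
  by_contra! h
  have hlt : ∀ i j, i < j → j ≤ Fintype.card Z → u (f (k + i)) < u (f (k + j)) := by
    intro i j hij
    induction j, hij using Nat.le_induction with
    | base => exact fun hj => h (k + i) (by omega) (by omega)
    | succ j _ ih => exact fun hj => (ih (by omega)).trans (h (k + j) (by omega) (by omega))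
  have hinj : Function.Injective fun i : Fin (Fintype.card Z + 1) => f (k + i) := by
    intro i j hij
    simp only at hij
    by_contra hne
    rcases lt_or_gt_of_ne hne with hl | hl
    · exact (hlt i j hl (by omega)).ne (by rw [hij])
    · exact (hlt j i hl (by omega)).ne (by rw [hij])
  simpa using Fintype.card_le_of_injective _ hinj

/-- If every revisit strictly increases `u`, then every `|Z|` consecutive steps visit
a new point. -/
lemma card_image_range_add_card_of_revisit_lt {Z : Type*} [Fintype Z] [DecidableEq Z]
    {α : Type*} [Preorder α] (u : Z → α) (f : ℕ → Z) (n k : ℕ)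
    (h : ∀ l ≤ n, (∃ j ≤ l, f (l + 1) = f j) → u (f l) < u (f (l + 1)))
    (hk : k + Fintype.card Z ≤ n + 1) :
    ((Finset.range (k + 1)).image f).card + 1 ≤
      ((Finset.range (k + Fintype.card Z + 1)).image f).card := by
  obtain ⟨l, hkl, hl, hu⟩ := exists_step_not_lt u f k
  have hnew : f (l + 1) ∉ (Finset.range (l + 1)).image f := by
    intro hmem
    obtain ⟨j, hj, hfj⟩ := Finset.mem_image.1 hmem
    exact hu (h l (by omega) ⟨j, Nat.lt_succ_iff.1 (Finset.mem_range.1 hj), hfj.symm⟩)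
  calc ((Finset.range (k + 1)).image f).card + 1
      ≤ ((Finset.range (l + 1)).image f).card + 1 := by gcongr
    _ = ((Finset.range (l + 1 + 1)).image f).card := by
        rw [Finset.range_add_one (n := l + 1), Finset.image_insert,
          Finset.card_insert_of_notMem hnew]
    _ ≤ _ := Finset.card_le_card (Finset.image_subset_image (Finset.range_mono (by omega)))

/-- Abstract combinatorial core of Lemma 3: if `z_0, …, z_{n+1}`
is a sequence in a finite set `Z` with `z_1 ≠ z_0` such that every revisit strictly
increases the value of `u` (whenever `z_{ℓ+1} ∈ {z_0, …, z_ℓ}` one has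
`u(z_{ℓ+1}) > u(z_ℓ)`), then `n < (|Z| − 1)·|Z|`. -/
theorem revisit_improving_sequence_length_bound
    {Z : Type*} [Fintype Z] [Nonempty Z] (u : Z → ℝ)
    (n : ℕ) (zs : ℕ → Z) (hne : zs 1 ≠ zs 0)
    (himp : ∀ ℓ ≤ n, (∃ j ≤ ℓ, zs (ℓ + 1) = zs j) → u (zs ℓ) < u (zs (ℓ + 1))) :
    n < (Fintype.card Z - 1) * Fintype.card Z := by
  classical
  by_contra! hn
  have hcard : ∀ m, 1 + m * Fintype.card Z ≤ n + 1 →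
      m + 2 ≤ ((Finset.range (1 + m * Fintype.card Z + 1)).image zs).card := by
    intro m
    induction m with
    | zero => simp [Finset.range_add_one, Finset.card_pair hne]
    | succ m ih =>
      intro hm
      rw [add_mul, one_mul, ← add_assoc] at hm ⊢
      have := card_image_range_add_card_of_revisit_lt u zs n _ himp hm
      have := ih (by omega)
      omega
  have := hcard (Fintype.card Z - 1) (by omega)
  have := this.trans (Finset.card_le_univ _)
  omega
end

section
/- Let (a_t)_{t∈ℕ} be a sequence of nonnegative real numbers and (t_k)_{k∈ℕ} a strictly increasing sequence of natural numbers such that: (i) a_{t_k} → 0 as k → ∞; (ii) |a_{t_k + 1} − a_{t_k}| → 0 as k → ∞; and (iii) a_{t+1} ≤ a_t for every t ∈ ℕ with t ∉ {t_k : k ∈ ℕ}. Then lim_{t→∞} a_t = 0. -/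
open Filter

/-- Abstract sequence argument from the final step of the proof of
Theorem 1: a nonnegative sequence that vanishes along a strictly increasing sequence
of indices, has vanishing increments at those indices, and is nonincreasing at all
other indices, converges to `0`. -/
theorem tendsto_zero_of_subseq_and_monotone
    (a : ℕ → ℝ) (ha : ∀ t, 0 ≤ a t)
    (tk : ℕ → ℕ) (htk : StrictMono tk)
    (h1 : Tendsto (fun k => a (tk k)) atTop (nhds 0))
    (h2 : Tendsto (fun k => |a (tk k + 1) - a (tk k)|) atTop (nhds 0))
    (h3 : ∀ t : ℕ, t ∉ Set.range tk → a (t + 1) ≤ a t) :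
    Tendsto a atTop (nhds 0) := by
  have h_succ : Tendsto (fun k => a (tk k + 1)) atTop (nhds 0) := by
    simpa using ((tendsto_zero_iff_abs_tendsto_zero _).2 h2).add h1
  refine Metric.tendsto_atTop.2 fun ε hε => ?_
  obtain ⟨K, hK⟩ := eventually_atTop.1
    ((h1.eventually_lt_const hε).and (h_succ.eventually_lt_const hε))
  refine ⟨tk K, fun t ht => ?_⟩
  rw [Real.dist_0_eq_abs, abs_of_nonneg (ha t)]
  induction t, ht using Nat.le_induction with
  | base => exact (hK K le_rfl).1
  | succ t ht ih =>
    by_cases hmem : t ∈ Set.range tk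
    · obtain ⟨k, rfl⟩ := hmem
      exact (hK k (htk.le_iff_le.1 ht)).2
    · exact (h3 t hmem).trans_lt ih
end
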